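/- Let n ≥ 1, 0 < γ < n, let p⃗, q⃗ be n-tuples with 1 < pᵢ, qᵢ < ∞, let s⃗ be an n-tuple with 1 < sᵢ ≤ ∞, and let α, β satisfy (1/n)Σᵢ 1/sᵢ ≤ 1/α ≤ (1/n)Σᵢ 1/pᵢ and (1/n)Σᵢ 1/sᵢ ≤ 1/β ≤ (1/n)Σᵢ 1/qᵢ. Assume γ = Σᵢ 1/pᵢ − Σᵢ 1/qᵢ = n/α − n/β. If b is locally integrable and there is a constant C > 0 such that ‖[b,I_γ]f‖_{(L^{q⃗},L^{s⃗})^β} ≤ C·‖f‖_{(L^{p⃗},L^{s⃗})^α} for all f ∈ (L^{p⃗},L^{s⃗})^α(ℝⁿ), then b ∈ BMO(ℝⁿ). -/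

import Mathlib

open MeasureTheory ENNReal Filter Topology Set

noncomputable section

namespace MixedAmalgam

/-- `L^p` norm over `ℝ` of an `ℝ≥0∞`-valued function, with the usual
modification (`essSup`) for `p = ∞`. -/
def lpInt (p : ℝ≥0∞) (g : ℝ → ℝ≥0∞) : ℝ≥0∞ :=
  if p = ∞ then essSup g volume else (∫⁻ t, g t ^ p.toReal) ^ (1 / p.toReal)

/-- `ℓ^p` norm over `ℤ` of an `ℝ≥0∞`-valued family, with the usual
modification for `p = ∞`. -/
def lpSum (p : ℝ≥0∞) (g : ℤ → ℝ≥0∞) : ℝ≥0∞ :=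
  if p = ∞ then ⨆ k, g k else (∑' k, g k ^ p.toReal) ^ (1 / p.toReal)

/-- Iterated mixed Lebesgue norm of an `ℝ≥0∞`-valued function on `ℝⁿ`,
taking the `L^{p₁}` norm in the first variable innermost, and the `L^{pₙ}`
norm in the last variable outermost. -/
def mixedE : (n : ℕ) → (Fin n → ℝ≥0∞) → ((Fin n → ℝ) → ℝ≥0∞) → ℝ≥0∞
  | 0, _, g => g Fin.elim0
  | n + 1, p, g =>
    lpInt (p (Fin.last n)) fun t =>
      mixedE n (fun i => p i.castSucc) fun x => g (Fin.snoc x t)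

/-- Mixed-norm Lebesgue norm `‖f‖_{L^{p⃗}}` of a real-valued function on `ℝⁿ`. -/
def mixedLp (n : ℕ) (p : Fin n → ℝ≥0∞) (f : (Fin n → ℝ) → ℝ) : ℝ≥0∞ :=
  mixedE n p fun x => (‖f x‖₊ : ℝ≥0∞)

/-- Iterated mixed `ℓ^{s⃗}` norm of an `ℝ≥0∞`-valued family indexed by `ℤⁿ`. -/
def mixedSeq : (n : ℕ) → (Fin n → ℝ≥0∞) → ((Fin n → ℤ) → ℝ≥0∞) → ℝ≥0∞
  | 0, _, a => a Fin.elim0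
  | n + 1, s, a =>
    lpSum (s (Fin.last n)) fun k =>
      mixedSeq n (fun i => s i.castSucc) fun m => a (Fin.snoc m k)

/-- Open Euclidean ball of center `y` and radius `r` in `ℝⁿ`. -/
def eball (n : ℕ) (y : Fin n → ℝ) (r : ℝ) : Set (Fin n → ℝ) :=
  {x | Real.sqrt (∑ i, (x i - y i) ^ 2) < r}

/-- `Σᵢ 1/pᵢ` as a real number. -/
def invSum (n : ℕ) (p : Fin n → ℝ≥0∞) : ℝ :=
  ∑ i, (1 / p i).toReal

/-- The `(L^{p⃗},L^{s⃗})` amalgam norm computed with balls of radius `r`. -/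
def amalgamNormR (n : ℕ) (p s : Fin n → ℝ≥0∞) (r : ℝ) (f : (Fin n → ℝ) → ℝ) : ℝ≥0∞ :=
  mixedE n s fun y => mixedLp n p ((eball n y r).indicator f)

/-- The amalgam norm `‖f‖_{(L^{p⃗},L^{s⃗})}`. -/
def amalgamNorm (n : ℕ) (p s : Fin n → ℝ≥0∞) (f : (Fin n → ℝ) → ℝ) : ℝ≥0∞ :=
  amalgamNormR n p s 1 f

/-- The amalgam norm `‖f‖_{(L^{p⃗},L^{s⃗})^α}`. -/
def amalgamNormA (n : ℕ) (p s : Fin n → ℝ≥0∞) (α : ℝ≥0∞) (f : (Fin n → ℝ) → ℝ) : ℝ≥0∞ :=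
  ⨆ (r : ℝ) (_ : 0 < r),
    mixedE n s fun y =>
      volume (eball n y r) ^
          ((1 / α).toReal - invSum n p / (n : ℝ) - invSum n s / (n : ℝ)) *
        mixedLp n p ((eball n y r).indicator f)

/-- The amalgam norm `‖·‖_{(L^{p⃗},L^{s⃗})^α}` for `ℝ≥0∞`-valued functions. -/
def amalgamNormAE (n : ℕ) (p s : Fin n → ℝ≥0∞) (α : ℝ≥0∞)
    (g : (Fin n → ℝ) → ℝ≥0∞) : ℝ≥0∞ :=
  ⨆ (r : ℝ) (_ : 0 < r),
    mixedE n s fun y =>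
      volume (eball n y r) ^
          ((1 / α).toReal - invSum n p / (n : ℝ) - invSum n s / (n : ℝ)) *
        mixedE n p ((eball n y r).indicator g)

/-- The cube `Q_{r,k} = r(k + [0,1)ⁿ)`. -/
def qcube (n : ℕ) (r : ℝ) (k : Fin n → ℤ) : Set (Fin n → ℝ) :=
  {x | ∀ i, r * (k i : ℝ) ≤ x i ∧ x i < r * ((k i : ℝ) + 1)}

/-- The discrete amalgam norm `_r‖f‖_{p⃗,s⃗}`. -/
def discNormR (n : ℕ) (p s : Fin n → ℝ≥0∞) (r : ℝ) (f : (Fin n → ℝ) → ℝ) : ℝ≥0∞ :=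
  mixedSeq n s fun k => mixedLp n p ((qcube n r k).indicator f)

/-- The discrete amalgam norm `‖f‖_{p⃗,s⃗} = _1‖f‖_{p⃗,s⃗}`. -/
def discNorm (n : ℕ) (p s : Fin n → ℝ≥0∞) (f : (Fin n → ℝ) → ℝ) : ℝ≥0∞ :=
  discNormR n p s 1 f

/-- The discrete amalgam norm
`‖f‖_{p⃗,s⃗,α} = sup_{r>0} r^{n/α - Σᵢ 1/pᵢ} · _r‖f‖_{p⃗,s⃗}`. -/
def discNormA (n : ℕ) (p s : Fin n → ℝ≥0∞) (α : ℝ≥0∞) (f : (Fin n → ℝ) → ℝ) : ℝ≥0∞ :=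
  ⨆ (r : ℝ) (_ : 0 < r),
    ENNReal.ofReal (r ^ ((n : ℝ) * (1 / α).toReal - invSum n p)) * discNormR n p s r f

/-- Membership in `(L^{p⃗},L^{s⃗})^α(ℝⁿ)` (continuous form). -/
def memA (n : ℕ) (p s : Fin n → ℝ≥0∞) (α : ℝ≥0∞) (f : (Fin n → ℝ) → ℝ) : Prop :=
  LocallyIntegrable f volume ∧ amalgamNormA n p s α f < ∞

/-- Membership in `(L^{p⃗},ℓ^{s⃗})(ℝⁿ)`. -/
def memD (n : ℕ) (p s : Fin n → ℝ≥0∞) (f : (Fin n → ℝ) → ℝ) : Prop :=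
  LocallyIntegrable f volume ∧ discNorm n p s f < ∞

/-- Membership in `(L^{p⃗},ℓ^{s⃗})^α(ℝⁿ)`. -/
def memDA (n : ℕ) (p s : Fin n → ℝ≥0∞) (α : ℝ≥0∞) (f : (Fin n → ℝ) → ℝ) : Prop :=
  LocallyIntegrable f volume ∧ discNormA n p s α f < ∞

/-- The dilation `St_r^{(α)} f = r^{-n/α} f(r⁻¹ ·)`. -/
def dil (n : ℕ) (α : ℝ≥0∞) (r : ℝ) (f : (Fin n → ℝ) → ℝ) : (Fin n → ℝ) → ℝ :=
  fun x => r ^ (-((n : ℝ) * (1 / α).toReal)) * f (r⁻¹ • x)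

/-- A block decomposition `f = Σ_j c_j St_{r_j}^{(α')} f_j` converging in `L¹_loc`. -/
structure BlockDecomp (n : ℕ) (p' s' : Fin n → ℝ≥0∞) (α' : ℝ≥0∞) (f : (Fin n → ℝ) → ℝ)
    (c : ℕ → ℝ) (rr : ℕ → ℝ) (g : ℕ → (Fin n → ℝ) → ℝ) : Prop where
  csummable : Summable fun j => |c j|
  rpos : ∀ j, 0 < rr j
  gloc : ∀ j, LocallyIntegrable (g j) volume
  gnorm : ∀ j, discNorm n p' s' (g j) ≤ 1
  conv : ∀ K : Set (Fin n → ℝ), IsCompact K →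
    Tendsto (fun J : ℕ =>
        ∫⁻ x in K,
          (‖f x - ∑ j ∈ Finset.range J, c j * dil n α' (rr j) (g j) x‖₊ : ℝ≥0∞))
      atTop (𝓝 0)

/-- Membership in the block space `H(p⃗',s⃗',α')`. -/
def memH (n : ℕ) (p' s' : Fin n → ℝ≥0∞) (α' : ℝ≥0∞) (f : (Fin n → ℝ) → ℝ) : Prop :=
  LocallyIntegrable f volume ∧ ∃ c rr g, BlockDecomp n p' s' α' f c rr g

/-- The norm of the block space `H(p⃗',s⃗',α')`. -/
def hNorm (n : ℕ) (p' s' : Fin n → ℝ≥0∞) (α' : ℝ≥0∞) (f : (Fin n → ℝ) → ℝ) : ℝ≥0∞ :=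
  ⨅ (c : ℕ → ℝ) (rr : ℕ → ℝ) (g : ℕ → (Fin n → ℝ) → ℝ)
    (_ : BlockDecomp n p' s' α' f c rr g), ENNReal.ofReal (∑' j, |c j|)

/-- The fractional integral operator `I_γ`. -/
def fracInt (n : ℕ) (γ : ℝ) (f : (Fin n → ℝ) → ℝ) : (Fin n → ℝ) → ℝ :=
  fun x => ∫ y, f y / Real.sqrt (∑ i, (x i - y i) ^ 2) ^ ((n : ℝ) - γ)

/-- The fractional maximal operator `M_γ`. -/
def fracMax (n : ℕ) (γ : ℝ) (f : (Fin n → ℝ) → ℝ) : (Fin n → ℝ) → ℝ≥0∞ :=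
  fun x => ⨆ (y : Fin n → ℝ) (r : ℝ) (_ : 0 < r) (_ : x ∈ eball n y r),
    volume (eball n y r) ^ (γ / (n : ℝ) - 1) * ∫⁻ z in eball n y r, (‖f z‖₊ : ℝ≥0∞)

/-- The commutator `[b, I_γ] f`. -/
def commFracInt (n : ℕ) (γ : ℝ) (b f : (Fin n → ℝ) → ℝ) : (Fin n → ℝ) → ℝ :=
  fun x => ∫ y, (b x - b y) * f y / Real.sqrt (∑ i, (x i - y i) ^ 2) ^ ((n : ℝ) - γ)

/-- The mean value `b_B` of `b` over the ball `B(y,r)`. -/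
def ballAvg (n : ℕ) (b : (Fin n → ℝ) → ℝ) (y : Fin n → ℝ) (r : ℝ) : ℝ :=
  (volume (eball n y r)).toReal⁻¹ * ∫ x in eball n y r, b x

/-- The `BMO` norm `sup_B (1/|B|) ∫_B |b - b_B|`. -/
def bmoNorm (n : ℕ) (b : (Fin n → ℝ) → ℝ) : ℝ≥0∞ :=
  ⨆ (y : Fin n → ℝ) (r : ℝ) (_ : 0 < r),
    ENNReal.ofReal
      ((volume (eball n y r)).toReal⁻¹ * ∫ x in eball n y r, |b x - ballAvg n b y r|)

/-! helpers -/
lemma lpInt_mono (p : ℝ≥0∞) {g h : ℝ → ℝ≥0∞} (hgh : ∀ t, g t ≤ h t) :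
    lpInt p g ≤ lpInt p h := by
  unfold lpInt
  split_ifs
  · exact essSup_mono_ae (Eventually.of_forall hgh)
  · gcongr with t
    exact hgh t

lemma mixedE_mono : ∀ (n : ℕ) (p : Fin n → ℝ≥0∞) {g h : (Fin n → ℝ) → ℝ≥0∞},
    (∀ t, g t ≤ h t) → mixedE n p g ≤ mixedE n p h
  | 0, _, _, _, hgh => hgh _
  | n + 1, p, _, _, hgh => lpInt_mono _ fun t => mixedE_mono n _ fun x => hgh _

lemma lpInt_ind (p : ℝ≥0∞) (hp : 1 < p) (A : Set ℝ) (hA : MeasurableSet A)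
    (h0 : volume A ≠ 0) (c : ℝ≥0∞) :
    lpInt p (A.indicator fun _ => c) = c * volume A ^ (1 / p).toReal := by
  unfold lpInt
  split_ifs with h
  · rw [essSup_indicator_eq_essSup_restrict hA, essSup_const]
    · simp [h]
    · simpa using h0
  · have hp0 : 0 < p.toReal := ENNReal.toReal_pos (by positivity) h
    have : (fun t => (A.indicator (fun _ => c) t) ^ p.toReal) =
        A.indicator fun _ => c ^ p.toReal := by
      ext t
      by_cases ht : t ∈ A <;> simp [ht, hp0]
    rw [this, lintegral_indicator_const hA, ENNReal.mul_rpow_of_nonneg _ _ (by positivity),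
      ← ENNReal.rpow_mul]
    simp [hp0.ne', ENNReal.toReal_inv]

lemma mixedE_ind : ∀ (n : ℕ) (p : Fin n → ℝ≥0∞) (_ : ∀ i, 1 < p i) (A : Fin n → Set ℝ)
    (_ : ∀ i, MeasurableSet (A i)) (_ : ∀ i, volume (A i) ≠ 0) (c : ℝ≥0∞),
    mixedE n p ((Set.univ.pi A).indicator fun _ => c) =
      c * ∏ i, volume (A i) ^ (1 / p i).toReal
  | 0, p, hp, A, hA, h0, c => by simp [mixedE]
  | n + 1, p, hp, A, hA, h0, c => by
    have key : ∀ t : ℝ, (fun x : Fin n → ℝ => (Set.univ.pi A).indicator (fun _ => c) 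
        (Fin.snoc x t : Fin (n+1) → ℝ)) = (Set.univ.pi fun i => A (Fin.castSucc i)).indicator
          (fun _ => (A (Fin.last n)).indicator (fun _ => c) t) := by
      intro t
      ext x
      have hiff : (Fin.snoc x t : Fin (n+1) → ℝ) ∈ Set.univ.pi A ↔
          (x ∈ Set.univ.pi fun i => A (Fin.castSucc i)) ∧ t ∈ A (Fin.last n) := by
        constructor
        · intro h
          refine ⟨fun i _ => ?_, ?_⟩
          · simpa using h i.castSucc (Set.mem_univ _)
          · simpa using h (Fin.last n) (Set.mem_univ _)
        · rintro ⟨h1, h2⟩ i _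
          induction i using Fin.lastCases with
          | last => simpa using h2
          | cast i => simpa using h1 i (Set.mem_univ _)
      by_cases h : (Fin.snoc x t : Fin (n+1) → ℝ) ∈ Set.univ.pi A
      · rw [Set.indicator_of_mem h, Set.indicator_of_mem (hiff.1 h).1,
          Set.indicator_of_mem (hiff.1 h).2]
      · rw [Set.indicator_of_notMem h]
        by_cases hx : x ∈ Set.univ.pi fun i => A (Fin.castSucc i)
        · rw [Set.indicator_of_mem hx, Set.indicator_of_notMem]
          exact fun ht => h (hiff.2 ⟨hx, ht⟩)
        · rw [Set.indicator_of_notMem hx]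
    simp only [mixedE, key]
    have h2 : ∀ t : ℝ, mixedE n (fun i => p i.castSucc)
        ((Set.univ.pi fun i => A (Fin.castSucc i)).indicator
          (fun _ => (A (Fin.last n)).indicator (fun _ => c) t)) =
        (A (Fin.last n)).indicator (fun _ => c * ∏ i : Fin n, volume (A i.castSucc) ^ (1 / p i.castSucc).toReal) t := by
      intro t
      rw [mixedE_ind n _ (fun i => hp _) _ (fun i => hA _) (fun i => h0 _)]
      by_cases ht : t ∈ A (Fin.last n) <;> simp [ht]
    simp only [h2]
    have := lpInt_ind (p (Fin.last n)) (hp _) _ (hA (Fin.last n)) (h0 _) (c * ∏ i : Fin n, volume (A i.castSucc) ^ (1 / p i.castSucc).toReal)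
    rw [Fin.prod_univ_castSucc, ← mul_assoc, ← this]

lemma lpInt_holder (p : ℝ≥0∞) (hp : 1 < p) (hp' : p < ∞) (A : Set ℝ) (hA : MeasurableSet A)
    (g : ℝ → ℝ≥0∞) (hg : ∀ t, t ∉ A → g t = 0) :
    ∫⁻ t, g t ≤ lpInt p g * volume A ^ (1 - (1 / p).toReal) := by
  obtain ⟨g', hm, hle, heq⟩ := exists_measurable_le_lintegral_eq volume g
  have hp1 : 1 < p.toReal := by
    rw [← ENNReal.toReal_one]; exact (ENNReal.toReal_lt_toReal (by simp) hp'.ne).2 hp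
  have hc := Real.HolderConjugate.conjExponent hp1
  have h1 := ENNReal.lintegral_mul_le_Lp_mul_Lq volume hc hm.aemeasurable
    (g := A.indicator fun _ => 1) (measurable_const.indicator hA).aemeasurable
  have h2 : ∀ t, (g' * A.indicator fun _ => (1 : ℝ≥0∞)) t = g' t := by
    intro t
    by_cases ht : t ∈ A
    · simp [ht]
    · have := hle t
      rw [hg t ht] at this
      simp [ht, le_antisymm this (by simp)]
  have h3 : (fun t => (A.indicator (fun _ => (1 : ℝ≥0∞)) t) ^ p.toReal.conjExponent) =
      A.indicator fun _ => 1 := by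
    ext t
    by_cases ht : t ∈ A <;> simp [ht, hc.symm.pos]
  simp only [h2, h3] at h1
  rw [lintegral_indicator_const hA, one_mul] at h1
  rw [heq]
  refine h1.trans ?_
  have h4 : 1 / p.toReal.conjExponent = 1 - (1 / p).toReal := by
    have := hc.inv_add_inv_eq_one
    simp [ENNReal.toReal_inv]
    linarith
  rw [h4]
  gcongr
  have := lpInt_mono p hle
  rw [lpInt, if_neg hp'.ne] at this
  exact this

lemma mixedE_holder : ∀ (n : ℕ) (p : Fin n → ℝ≥0∞) (_ : ∀ i, 1 < p i ∧ p i < ∞)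
    (A : Fin n → Set ℝ) (_ : ∀ i, MeasurableSet (A i)) (_ : ∀ i, volume (A i) ≠ 0) 
    (_ : ∀ i, volume (A i) ≠ ∞)
    (g : (Fin n → ℝ) → ℝ≥0∞) (_ : ∀ x, x ∉ Set.univ.pi A → g x = 0),
    ∫⁻ x, g x ≤ mixedE n p g * ∏ i, volume (A i) ^ (1 - (1 / p i).toReal)
  | 0, p, hp, A, hA, h0, h1, g, hg => by 
    rw [lintegral_unique]
    simp [mixedE, volume_pi]
    exact le_of_eq (congrArg _ (Subsingleton.elim _ _))
  | n + 1, p, hp, A, hA, h0, h1, g, hg => by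
    have e := (volume_preserving_piFinSuccAbove (fun _ : Fin (n+1) => ℝ) (Fin.last n)).symm
    rw [← e.lintegral_comp_emb (MeasurableEquiv.measurableEmbedding _)]
    refine (lintegral_prod_le _).trans ?_
    have hs : ∀ (t : ℝ) (x : Fin n → ℝ), (MeasurableEquiv.piFinSuccAbove (fun _ : Fin (n+1) => ℝ) (Fin.last n)).symm (t, x) = Fin.snoc x t := by
      intro t x
      exact Fin.insertNth_last' _ _
    simp only [hs]
    have ih : ∀ t, ∫⁻ x, g (Fin.snoc x t : Fin (n+1) → ℝ) ≤ mixedE n (fun i => p i.castSucc) (fun x => g (Fin.snoc x t : Fin (n+1) → ℝ)) * ∏ i : Fin n, volume (A i.castSucc) ^ (1 - (1 / p i.castSucc).toReal) := by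
      intro t
      refine mixedE_holder n _ (fun i => hp _) (fun i => A i.castSucc) (fun i => hA _) (fun i => h0 _) (fun i => h1 _) _ ?_
      intro x hx
      apply hg
      contrapose! hx
      intro i _
      have := hx i.castSucc (Set.mem_univ _)
      simpa using this
    refine (lintegral_mono ih).trans ?_
    rw [lintegral_mul_const']
    · rw [Fin.prod_univ_castSucc, mixedE, mul_comm (∏ i : Fin n, volume (A i.castSucc) ^ (1 - (1 / p i.castSucc).toReal)), ← mul_assoc]
      gcongr
      refine lpInt_holder _ (hp _).1 (hp _).2 _ (hA _) _ ?_
      intro t ht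
      have : (fun x : Fin n → ℝ => g (Fin.snoc x t : Fin (n+1) → ℝ)) = (Set.univ.pi fun _ : Fin n => Ioo (0:ℝ) 1).indicator fun _ => 0 := by
        ext x
        rw [hg]
        · simp
        · intro h
          have := h (Fin.last n) (Set.mem_univ _)
          simp at this
          exact ht this
      rw [this, mixedE_ind _ _ (fun i => (hp _).1) _ (fun i => measurableSet_Ioo)]
      · simp
      · simp
    · refine ENNReal.prod_ne_top fun i _ => ?_
      exact ENNReal.rpow_ne_top_of_ne_zero (h0 _) (h1 _)

def bx (n : ℕ) (x : Fin n → ℝ) (R : ℝ) : Set (Fin n → ℝ) :=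
  Set.univ.pi fun i => Ioo (x i - R) (x i + R)

lemma mem_bx {n : ℕ} {x y : Fin n → ℝ} {R : ℝ} : y ∈ bx n x R ↔ ∀ i, |y i - x i| < R := by
  simp only [bx, Set.mem_pi, Set.mem_univ, true_imp_iff, Set.mem_Ioo, abs_lt]
  refine forall_congr' fun i => ⟨fun h => ⟨?_, ?_⟩, fun h => ⟨?_, ?_⟩⟩ <;> linarith [h.1, h.2]

lemma bx_meas (n : ℕ) (x : Fin n → ℝ) (R : ℝ) : MeasurableSet (bx n x R) :=
  MeasurableSet.univ_pi fun _ => measurableSet_Ioo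

lemma vol_bx (n : ℕ) (x : Fin n → ℝ) {R : ℝ} (hR : 0 < R) :
    volume (bx n x R) = ENNReal.ofReal ((2 * R) ^ (n : ℝ)) := by
  rw [bx, Real.volume_pi_Ioo]
  have : ∀ i, x i + R - (x i - R) = 2 * R := fun i => by ring
  simp only [this]
  simp [ENNReal.ofReal_pow (show (0:ℝ) ≤ 2 * R by positivity)]

lemma prod_vol (n : ℕ) (x : Fin n → ℝ) {R : ℝ} (hR : 0 < R) (e : Fin n → ℝ) :
    ∏ i, volume (Ioo (x i - R) (x i + R)) ^ (e i) = ENNReal.ofReal ((2 * R) ^ (∑ i, e i)) := by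
  have : ∀ i, x i + R - (x i - R) = 2 * R := fun i => by ring
  have h2 : (0:ℝ) < 2 * R := by positivity
  simp only [Real.volume_Ioo, this, ENNReal.ofReal_rpow_of_pos h2]
  rw [← ENNReal.ofReal_prod_of_nonneg (fun i _ => by positivity), Real.rpow_sum_of_pos h2]

lemma mixedE_bx (n : ℕ) (p : Fin n → ℝ≥0∞) (hp : ∀ i, 1 < p i) (x : Fin n → ℝ) {R : ℝ}
    (hR : 0 < R) (c : ℝ≥0∞) :
    mixedE n p ((bx n x R).indicator fun _ => c) = c * ENNReal.ofReal ((2 * R) ^ invSum n p) := by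
  rw [bx, mixedE_ind n p hp _ (fun i => measurableSet_Ioo), prod_vol n x hR, invSum]
  intro i
  simp
  linarith

lemma mixedE_bx_holder (n : ℕ) (p : Fin n → ℝ≥0∞) (hp : ∀ i, 1 < p i ∧ p i < ∞) (x : Fin n → ℝ)
    {R : ℝ} (hR : 0 < R) (g : (Fin n → ℝ) → ℝ≥0∞) :
    ∫⁻ y in bx n x R, g y ≤ mixedE n p ((bx n x R).indicator g) *
      ENNReal.ofReal ((2 * R) ^ ((n : ℝ) - invSum n p)) := by
  rw [← lintegral_indicator (bx_meas n x R)]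
  refine (mixedE_holder n p hp (fun i => Ioo (x i - R) (x i + R)) (fun i => measurableSet_Ioo)
    ?_ ?_ ((bx n x R).indicator g) ?_).trans ?_
  · intro i
    simp
    linarith
  · simp
  · intro y hy
    exact Set.indicator_of_notMem hy _
  · rw [prod_vol n x hR]
    simp [invSum]

lemma eball_sub_bx (n : ℕ) (y : Fin n → ℝ) (r : ℝ) : eball n y r ⊆ bx n y r := by
  intro x hx
  rw [mem_bx]
  intro i
  refine lt_of_le_of_lt ?_ hx
  apply Real.abs_le_sqrt
  exact Finset.single_le_sum (f := fun i => (x i - y i) ^ 2) (fun i _ => sq_nonneg _)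
    (Finset.mem_univ i)

lemma dist_le (n : ℕ) (x y : Fin n → ℝ) (r : ℝ) (hr : 0 < r) (h : ∀ i, |x i - y i| ≤ r) :
    Real.sqrt (∑ i, (x i - y i) ^ 2) < (n + 1) * r := by
  rw [Real.sqrt_lt' (by positivity)]
  have : ∑ i, (x i - y i) ^ 2 ≤ ∑ i : Fin n, r ^ 2 := by
    refine Finset.sum_le_sum fun i _ => ?_
    rw [← sq_abs]
    gcongr
    exact h i
  refine this.trans_lt ?_
  simp
  have : (0:ℝ) ≤ n := by positivity
  have := pow_pos hr 2
  nlinarith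

lemma bx_sub_eball (n : ℕ) (y : Fin n → ℝ) (r : ℝ) (hr : 0 < r) :
    bx n y r ⊆ eball n y ((n + 1) * r) := by
  intro x hx
  rw [mem_bx] at hx
  exact dist_le n x y r hr fun i => (hx i).le

lemma vol_eball_le (n : ℕ) (y : Fin n → ℝ) {r : ℝ} (hr : 0 < r) :
    volume (eball n y r) ≤ ENNReal.ofReal ((2 * r) ^ (n : ℝ)) :=
  (measure_mono (eball_sub_bx n y r)).trans_eq (vol_bx n y hr)

lemma le_vol_eball (n : ℕ) (y : Fin n → ℝ) {r : ℝ} (hr : 0 < r) :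
    ENNReal.ofReal ((2 * (r / (n + 1))) ^ (n : ℝ)) ≤ volume (eball n y r) := by
  rw [← vol_bx n y (by positivity)]
  refine (measure_mono (bx_sub_eball n y (r / (n + 1)) (by positivity))).trans_eq ?_
  congr 2
  field_simp

lemma enn_rpow_anti {e : ℝ} (he : e ≤ 0) {x y : ℝ≥0∞} (h : x ≤ y) : y ^ e ≤ x ^ e := by
  obtain ⟨d, rfl⟩ : ∃ d, e = -d := ⟨-e, by ring⟩
  rw [ENNReal.rpow_neg, ENNReal.rpow_neg, ENNReal.inv_le_inv]
  exact ENNReal.rpow_le_rpow h (by linarith)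

lemma vol_pow_le (n : ℕ) (y : Fin n → ℝ) {r : ℝ} (hr : 0 < r) {e : ℝ} (he : e ≤ 0) :
    volume (eball n y r) ^ e ≤ ENNReal.ofReal ((2 * (r / (n + 1))) ^ (n * e)) := by
  rw [Real.rpow_mul (by positivity), ← ENNReal.ofReal_rpow_of_pos (by positivity)]
  exact enn_rpow_anti he (le_vol_eball n y hr)

lemma le_vol_pow (n : ℕ) (y : Fin n → ℝ) {r : ℝ} (hr : 0 < r) {e : ℝ} (he : e ≤ 0) :
    ENNReal.ofReal ((2 * r) ^ (n * e)) ≤ volume (eball n y r) ^ e := by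
  rw [Real.rpow_mul (by positivity), ← ENNReal.ofReal_rpow_of_pos (by positivity)]
  exact enn_rpow_anti he (vol_eball_le n y hr)

lemma invSum_nonneg (n : ℕ) (p : Fin n → ℝ≥0∞) : 0 ≤ invSum n p :=
  Finset.sum_nonneg fun _ _ => ENNReal.toReal_nonneg

/-- upper bound of the amalgam norm of a test function -/
lemma norm_test (n : ℕ) (hn : 1 ≤ n) (p s : Fin n → ℝ≥0∞) (α : ℝ≥0∞)
    (hp : ∀ i, 1 < p i) (hs : ∀ i, 1 < s i)
    (hα1 : invSum n s / (n : ℝ) ≤ (1 / α).toReal)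
    (hα2 : (1 / α).toReal ≤ invSum n p / (n : ℝ)) :
    ∃ K : ℝ, 0 < K ∧ ∀ (x : Fin n → ℝ) (R : ℝ) (_ : 0 < R) (f : (Fin n → ℝ) → ℝ)
      (_ : ∀ y, ‖f y‖ ≤ (bx n x R).indicator 1 y),
      amalgamNormA n p s α f ≤ ENNReal.ofReal (K * R ^ (n * (1 / α).toReal)) := by
  have hn' : (0:ℝ) < n := by exact_mod_cast hn
  set P := invSum n p with hP
  set S := invSum n s with hS
  set a := n * (1 / α).toReal with ha
  have hSa : S ≤ a := by rw [div_le_iff₀ hn'] at hα1; linarith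
  have haP : a ≤ P := by rw [le_div_iff₀ hn'] at hα2; linarith
  have hS0 : 0 ≤ S := invSum_nonneg _ _
  have he : (1 / α).toReal - P / n - S / n ≤ 0 := by
    have : 0 ≤ S / n := by positivity
    linarith
  have hne : n * ((1 / α).toReal - P / n - S / n) = a - P - S := by
    rw [ha]; field_simp
  refine ⟨(2 / (n + 1)) ^ (a - P - S) * 2 ^ P * 4 ^ S, by positivity, ?_⟩
  intro x R hR f hf
  refine iSup₂_le fun r hr => ?_
  have hmin : 0 < min r R := lt_min hr hR
  have hmax : 0 < max r R := lt_max_of_lt_left hr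
  have step1 : ∀ y, volume (eball n y r) ^ ((1 / α).toReal - P / n - S / n) *
      mixedLp n p ((eball n y r).indicator f) ≤
      (bx n x (2 * max r R)).indicator (fun _ => ENNReal.ofReal ((2 * (r / (n + 1))) ^ (a - P - S)) * ENNReal.ofReal ((2 * min r R) ^ P)) y := by
    intro y
    have hfp : ∀ z, (‖(eball n y r).indicator f z‖₊ : ℝ≥0∞) ≤ (bx n y r ∩ bx n x R).indicator (fun _ => 1) z := by
      intro z
      by_cases hz : z ∈ eball n y r
      · have hz' := eball_sub_bx n y r hz
        rw [Set.indicator_of_mem hz]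
        have := hf z
        by_cases hz2 : z ∈ bx n x R
        · rw [Set.indicator_of_mem (show z ∈ bx n y r ∩ bx n x R from ⟨hz', hz2⟩)]
          rw [Set.indicator_of_mem hz2] at this
          have h3 : ‖f z‖₊ ≤ 1 := this
          exact_mod_cast h3
        · rw [Set.indicator_of_notMem hz2] at this
          have : f z = 0 := norm_le_zero_iff.1 this
          simp [this]
      · simp [Set.indicator_of_notMem hz]
    by_cases hy : y ∈ bx n x (2 * max r R)
    · rw [Set.indicator_of_mem hy]
      gcongr
      · rw [← hne]; exact vol_pow_le n y hr he
      · obtain ⟨w, hw⟩ : ∃ w, bx n y r ∩ bx n x R ⊆ bx n w (min r R) := by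
          rcases le_total r R with h | h
          · exact ⟨y, by rw [min_eq_left h]; exact Set.inter_subset_left⟩
          · exact ⟨x, by rw [min_eq_right h]; exact Set.inter_subset_right⟩
        have := mixedE_bx n p hp w hmin 1
        rw [one_mul] at this
        rw [hP, ← this]
        refine mixedE_mono n p fun z => (hfp z).trans ?_
        exact Set.indicator_le_indicator_of_subset hw (by simp) z
    · have h0 : mixedLp n p ((eball n y r).indicator f) = 0 := by
        have := mixedE_bx n p hp y hr 0
        rw [zero_mul] at this
        rw [← le_zero_iff, ← this]
        refine mixedE_mono n p fun z => (hfp z).trans ?_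
        rw [Set.indicator_of_notMem]
        · simp
        · rintro ⟨h1, h2⟩
          apply hy
          rw [mem_bx] at *
          intro i
          have a1 := abs_lt.1 (h1 i)
          have a2 := abs_lt.1 (h2 i)
          have := le_max_left r R
          have := le_max_right r R
          rw [abs_lt]
          constructor <;> linarith
      rw [h0]; simp
  refine (mixedE_mono n s step1).trans ?_
  rw [mixedE_bx n s hs x (by positivity), ← ENNReal.ofReal_mul (by positivity), ← ENNReal.ofReal_mul (by positivity)]
  apply ENNReal.ofReal_le_ofReal
  rw [← hS]
  have e1 : (2 * (r / ((n:ℝ) + 1))) ^ (a - P - S) = (2 / (n + 1)) ^ (a - P - S) * r ^ (a - P - S) := by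
    rw [← Real.mul_rpow (by positivity) hr.le]; congr 1; ring
  have e2 : (2 * min r R) ^ P = 2 ^ P * (min r R) ^ P := Real.mul_rpow (by positivity) hmin.le
  have e3 : (2 * (2 * max r R)) ^ S = 4 ^ S * (max r R) ^ S := by
    rw [← Real.mul_rpow (by positivity) hmax.le]; congr 1; ring
  rw [e1, e2, e3]
  have key : r ^ (a - P - S) * (min r R) ^ P * (max r R) ^ S ≤ R ^ a := by
    rcases le_total r R with h | h
    · rw [min_eq_left h, max_eq_right h, ← Real.rpow_add hr]
      calc r ^ (a - P - S + P) * R ^ S = r ^ (a - S) * R ^ S := by congr 2; ring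
        _ ≤ R ^ (a - S) * R ^ S := by gcongr
        _ = R ^ a := by rw [← Real.rpow_add hR]; congr 1; ring
    · rw [min_eq_right h, max_eq_left h]
      calc r ^ (a - P - S) * R ^ P * r ^ S = r ^ (a - P) * R ^ P := by
            rw [mul_right_comm, ← Real.rpow_add hr]; congr 2; ring
        _ ≤ R ^ (a - P) * R ^ P := by
            gcongr ?_ * _
            exact Real.rpow_le_rpow_of_nonpos hR h (by linarith)
        _ = R ^ a := by rw [← Real.rpow_add hR]; congr 1; ring
  calc _ = ((2 / ((n:ℝ) + 1)) ^ (a - P - S) * 2 ^ P * 4 ^ S) * (r ^ (a - P - S) * (min r R) ^ P * (max r R) ^ S) := by ring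
    _ ≤ _ := by gcongr

/-- lower bound of the amalgam norm -/
lemma norm_lower (n : ℕ) (hn : 1 ≤ n) (q s : Fin n → ℝ≥0∞) (β : ℝ≥0∞)
    (hq : ∀ i, 1 < q i ∧ q i < ∞) (hs : ∀ i, 1 < s i)
    (hβ2 : (1 / β).toReal ≤ invSum n q / (n : ℝ)) :
    ∃ K : ℝ, 0 < K ∧ ∀ (x : Fin n → ℝ) (R : ℝ) (_ : 0 < R) (g : (Fin n → ℝ) → ℝ),
      ∫⁻ y in bx n x R, (‖g y‖₊ : ℝ≥0∞) ≤
      amalgamNormA n q s β g * ENNReal.ofReal (K * R ^ ((n : ℝ) - n * (1 / β).toReal)) := by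
  have hn' : (0:ℝ) < n := by exact_mod_cast hn
  set Q := invSum n q with hQ
  set S := invSum n s with hS
  set a := n * (1 / β).toReal with ha
  have hS0 : 0 ≤ S := invSum_nonneg _ _
  have he : (1 / β).toReal - Q / n - S / n ≤ 0 := by
    have : 0 ≤ S / n := by positivity
    linarith
  have hne : n * ((1 / β).toReal - Q / n - S / n) = a - Q - S := by
    rw [ha]; field_simp
  refine ⟨2 ^ ((n : ℝ) - Q) * (2 ^ S * (4 * ((n : ℝ) + 1)) ^ (a - Q - S))⁻¹, by positivity, ?_⟩
  intro x R hR g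
  set M := mixedE n q ((bx n x R).indicator fun y => (‖g y‖₊ : ℝ≥0∞)) with hM
  have hr : (0:ℝ) < (n + 1) * (2 * R) := by positivity
  have h1 : M * ENNReal.ofReal ((2 * ((n + 1) * (2 * R))) ^ (a - Q - S)) * ENNReal.ofReal ((2 * R) ^ S) ≤ amalgamNormA n q s β g := by
    refine le_trans ?_ (le_iSup₂_of_le ((n + 1) * (2 * R)) hr le_rfl)
    rw [hS, ← mixedE_bx n s hs x hR]
    refine mixedE_mono n s fun y => ?_
    by_cases hy : y ∈ bx n x R
    · rw [Set.indicator_of_mem hy, mul_comm]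
      gcongr
      · rw [← hne]; exact le_vol_pow n y hr he
      · refine mixedE_mono n q fun z => ?_
        by_cases hz : z ∈ bx n x R
        · have : z ∈ eball n y ((n + 1) * (2 * R)) := by
            apply bx_sub_eball n y _ (by positivity)
            rw [mem_bx] at *
            intro i
            have a1 := abs_lt.1 (hy i)
            have a2 := abs_lt.1 (hz i)
            rw [abs_lt]
            constructor <;> linarith
          rw [Set.indicator_of_mem hz, Set.indicator_of_mem this]
        · simp [Set.indicator_of_notMem hz]
    · simp [Set.indicator_of_notMem hy]
  refine (mixedE_bx_holder n q hq x hR _).trans ?_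
  rw [← hM, ← hQ]
  refine le_trans (le_of_eq ?_) (mul_le_mul_left h1 _)
  rw [mul_assoc, mul_assoc, ← ENNReal.ofReal_mul (by positivity), ← ENNReal.ofReal_mul (by positivity)]
  congr 2
  rw [show 2 * (((n:ℝ) + 1) * (2 * R)) = (4 * (n + 1)) * R by ring]
  rw [Real.mul_rpow (by positivity) hR.le, Real.mul_rpow (by positivity) hR.le, Real.mul_rpow (by positivity) hR.le]
  have : R ^ ((n:ℝ) - Q) = R ^ (a - Q - S) * R ^ S * R ^ (n - a) := by
    rw [← Real.rpow_add hR, ← Real.rpow_add hR]; congr 1; ring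
  rw [this]
  have : (0:ℝ) < (4 * (n + 1)) ^ (a - Q - S) := by positivity
  have : (0:ℝ) < 2 ^ S := by positivity
  field_simp

lemma exists_median (ν : Measure ℝ) [IsFiniteMeasure ν] :
    ∃ m, ν Set.univ / 2 ≤ ν (Iic m) ∧ ν Set.univ / 2 ≤ ν (Ici m) := by
  rcases eq_or_ne (ν Set.univ) 0 with h0 | h0
  · exact ⟨0, by simp [h0]⟩
  have hV : ν Set.univ ≠ ∞ := measure_ne_top _ _
  have hlt : ν Set.univ / 2 < ν Set.univ := ENNReal.half_lt_self h0 hV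
  have hpos : 0 < ν Set.univ / 2 := ENNReal.half_pos h0
  set S := {x : ℝ | ν Set.univ / 2 ≤ ν (Iic x)} with hS
  have hne : S.Nonempty := by
    have := (tendsto_measure_Iic_atTop ν).eventually (lt_mem_nhds hlt)
    obtain ⟨x, hx⟩ := this.exists
    exact ⟨x, hx.le⟩
  have hbd : BddBelow S := by
    have hE : (⋂ k : ℕ, Iic (-(k:ℝ))) = ∅ := by
      ext x
      simp only [Set.mem_iInter, Set.mem_Iic, Set.mem_empty_iff_false, iff_false, not_forall, not_le]
      obtain ⟨k, hk⟩ := exists_nat_gt (-x)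
      exact ⟨k, by linarith⟩
    have h1 : Tendsto (fun k : ℕ => ν (Iic (-(k:ℝ)))) atTop (𝓝 0) := by
      rw [← measure_empty (μ := ν), ← hE]
      refine tendsto_measure_iInter_atTop (fun k => measurableSet_Iic.nullMeasurableSet) ?_
        ⟨0, measure_ne_top _ _⟩
      intro i j hij
      apply Iic_subset_Iic.2
      have : (i:ℝ) ≤ j := by exact_mod_cast hij
      linarith
    obtain ⟨k, hx⟩ := (h1.eventually (gt_mem_nhds hpos)).exists
    refine ⟨-(k:ℝ), fun y hy => ?_⟩
    by_contra! hxy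
    have : ν (Iic y) ≤ ν (Iic (-(k:ℝ))) := measure_mono (Iic_subset_Iic.2 hxy.le)
    exact absurd (hy.trans this) (not_le.2 hx)
  set m := sInf S with hm
  have hk : ∀ k : ℕ, (0:ℝ) < 1 / ((k:ℝ) + 1) := fun k => by positivity
  have hlim : Tendsto (fun k : ℕ => 1 / ((k:ℝ) + 1)) atTop (𝓝 0) :=
    tendsto_one_div_add_atTop_nhds_zero_nat
  refine ⟨m, ?_, ?_⟩
  · have e : Iic m = ⋂ k : ℕ, Iic (m + 1 / ((k:ℝ) + 1)) := by
      ext x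
      simp only [Set.mem_iInter, Set.mem_Iic]
      refine ⟨fun h k => h.trans (by linarith [hk k]), fun h => ?_⟩
      have := (tendsto_const_nhds (x := m)).add hlim
      rw [add_zero] at this
      exact ge_of_tendsto' this h
    have ht : Tendsto (fun k : ℕ => ν (Iic (m + 1 / ((k:ℝ) + 1)))) atTop (𝓝 (ν (Iic m))) := by
      rw [e]
      refine tendsto_measure_iInter_atTop (fun k => measurableSet_Iic.nullMeasurableSet) ?_
        ⟨0, measure_ne_top _ _⟩
      intro i j hij
      apply Iic_subset_Iic.2
      have : 1 / ((j:ℝ) + 1) ≤ 1 / ((i:ℝ) + 1) := Nat.one_div_le_one_div hij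
      linarith
    refine ge_of_tendsto' ht fun k => ?_
    obtain ⟨y, hy, hy2⟩ := exists_lt_of_csInf_lt hne (show sInf S < m + 1 / ((k:ℝ) + 1) by linarith [hk k])
    exact le_trans hy (measure_mono (Iic_subset_Iic.2 hy2.le))
  · have e : Ici m = ⋂ k : ℕ, Ioi (m - 1 / ((k:ℝ) + 1)) := by
      ext x
      simp only [Set.mem_iInter, Set.mem_Ioi, Set.mem_Ici]
      refine ⟨fun h k => lt_of_lt_of_le (by linarith [hk k]) h, fun h => ?_⟩
      have := (tendsto_const_nhds (x := m)).sub hlim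
      rw [sub_zero] at this
      exact le_of_tendsto' this fun k => (h k).le
    have ht : Tendsto (fun k : ℕ => ν (Ioi (m - 1 / ((k:ℝ) + 1)))) atTop (𝓝 (ν (Ici m))) := by
      rw [e]
      refine tendsto_measure_iInter_atTop (fun k => measurableSet_Ioi.nullMeasurableSet) ?_
        ⟨0, measure_ne_top _ _⟩
      intro i j hij
      apply Ioi_subset_Ioi
      have : 1 / ((j:ℝ) + 1) ≤ 1 / ((i:ℝ) + 1) := Nat.one_div_le_one_div hij
      linarith
    refine ge_of_tendsto' ht fun k => ?_
    have hx : m - 1 / ((k:ℝ) + 1) ∉ S := fun h => by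
      have := csInf_le hbd h
      linarith [hk k]
    have hx' : ν (Iic (m - 1 / ((k:ℝ) + 1))) < ν Set.univ / 2 := not_le.1 hx
    by_contra! hc
    have : ν Set.univ ≤ ν (Iic (m - 1 / ((k:ℝ) + 1))) + ν (Ioi (m - 1 / ((k:ℝ) + 1))) := by
      refine le_trans (measure_mono ?_) (measure_union_le _ _)
      rw [Iic_union_Ioi]
    have h2 := ENNReal.add_lt_add hx' hc
    rw [ENNReal.add_halves] at h2
    exact absurd this (not_le.2 h2)

lemma comm_lower (n : ℕ) (hn : 1 ≤ n) (γ : ℝ) (hγn : γ < n)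
    (b b' : (Fin n → ℝ) → ℝ) (hb : LocallyIntegrable b volume) (hm' : Measurable b')
    (hbb : b =ᵐ[volume] b') (x₀ : Fin n → ℝ) (R : ℝ) (hR : 0 < R) (m : ℝ)
    (hE : volume (bx n (fun i => x₀ i + 4 * R) R) / 2 ≤
      volume (bx n (fun i => x₀ i + 4 * R) R ∩ {y | b' y ≤ m}))
    (x : Fin n → ℝ) (hx : x ∈ bx n x₀ R) :
    ENNReal.ofReal (b x - m) *
      ENNReal.ofReal ((((n + 1) * (6 * R)) ^ ((n:ℝ) - γ))⁻¹ * ((2 * R) ^ (n : ℝ) / 2)) ≤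
    (‖commFracInt n γ b ((bx n (fun i => x₀ i + 4 * R) R ∩ {y | b' y ≤ m}).indicator 1) x‖₊ : ℝ≥0∞) := by
  rcases le_or_gt (b x) m with hbm | hbm
  · rw [ENNReal.ofReal_of_nonpos (by linarith)]; simp
  set Q := bx n (fun i => x₀ i + 4 * R) R with hQ
  set E := Q ∩ {y | b' y ≤ m} with hEdef
  have hEm : MeasurableSet E := (bx_meas _ _ _).inter (measurableSet_le hm' measurable_const)
  have hQfin : volume Q ≠ ∞ := by rw [hQ, vol_bx n _ hR]; exact ENNReal.ofReal_ne_top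
  have hEfin : volume E ≠ ∞ := ne_top_of_le_ne_top hQfin (measure_mono Set.inter_subset_left)
  set d : (Fin n → ℝ) → ℝ := fun y => Real.sqrt (∑ i, (x i - y i) ^ 2) with hd
  have hdlow : ∀ y ∈ E, 2 * R ≤ d y := by
    intro y hy
    have h1 := abs_lt.1 (mem_bx.1 hx ⟨0, hn⟩)
    have h2 := abs_lt.1 (mem_bx.1 hy.1 ⟨0, hn⟩)
    have h3 : |x ⟨0, hn⟩ - y ⟨0, hn⟩| ≤ d y := by
      apply Real.abs_le_sqrt
      exact Finset.single_le_sum (f := fun i => (x i - y i) ^ 2) (fun i _ => sq_nonneg _)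
        (Finset.mem_univ _)
    have h4 := neg_abs_le (x ⟨0, hn⟩ - y ⟨0, hn⟩)
    linarith
  have hdup : ∀ y ∈ E, d y ≤ (n + 1) * (6 * R) := by
    intro y hy
    refine (dist_le n x y (6 * R) (by positivity) fun i => ?_).le
    have h1 := abs_lt.1 (mem_bx.1 hx i)
    have h2 := abs_lt.1 (mem_bx.1 hy.1 i)
    rw [abs_le]
    constructor <;> linarith
  have hrew : commFracInt n γ b (E.indicator 1) x =
      ∫ y in E, (b x - b' y) * (d y ^ ((n:ℝ) - γ))⁻¹ := by
    rw [← integral_indicator hEm]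
    apply integral_congr_ae
    filter_upwards [hbb] with y hy
    by_cases hyE : y ∈ E
    · simp [hyE, hy, hd, div_eq_mul_inv]
    · simp [hyE]
  have hcpt : E ⊆ Metric.closedBall (fun i => x₀ i + 4 * R) R := by
    intro y hy
    rw [Metric.mem_closedBall, dist_pi_le_iff hR.le]
    intro i
    exact (mem_bx.1 hy.1 i).le
  have hb'int : IntegrableOn b' E := by
    refine IntegrableOn.congr_fun_ae ?_ (ae_restrict_of_ae hbb)
    exact (hb.integrableOn_isCompact (isCompact_closedBall _ _)).mono_set hcpt
  have hint : IntegrableOn (fun y => (b x - b' y) * (d y ^ ((n:ℝ) - γ))⁻¹) E := by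
    refine Integrable.mul_bdd (c := ((2 * R) ^ ((n:ℝ) - γ))⁻¹) ?_ ?_ ?_
    · exact (integrableOn_const hEfin).sub hb'int
    · have : Measurable fun y => (d y ^ ((n:ℝ) - γ))⁻¹ := by
        simp only [hd]; fun_prop
      exact this.aestronglyMeasurable
    · refine (ae_restrict_iff' hEm).2 (Eventually.of_forall fun y hy => ?_)
      have h1 := hdlow y hy
      have : 0 < d y := by linarith
      rw [Real.norm_of_nonneg (by positivity)]
      gcongr
  have hge : (volume E).toReal * ((b x - m) * (((n + 1) * (6 * R)) ^ ((n:ℝ) - γ))⁻¹) ≤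
      ∫ y in E, (b x - b' y) * (d y ^ ((n:ℝ) - γ))⁻¹ := by
    have : ∫ y in E, ((b x - m) * (((n + 1) * (6 * R)) ^ ((n:ℝ) - γ))⁻¹) = (volume E).toReal * ((b x - m) * (((n + 1) * (6 * R)) ^ ((n:ℝ) - γ))⁻¹) := by
      simp [Measure.real]
    rw [← this]
    refine setIntegral_mono_on (integrableOn_const hEfin) hint hEm fun y hy => ?_
    have h1 := hdlow y hy
    have h2 := hdup y hy
    have h3 : 0 < d y := by linarith
    have h4 : b' y ≤ m := hy.2
    have : 0 ≤ (n:ℝ) - γ := by linarith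
    have : 0 < b x - m := by linarith
    have : 0 ≤ b x - b' y := by linarith
    gcongr
  have hvE : (2 * R) ^ (n:ℝ) / 2 ≤ (volume E).toReal := by
    rw [hQ, vol_bx n _ hR] at hE
    have := ENNReal.toReal_mono hEfin hE
    rwa [ENNReal.toReal_div, ENNReal.toReal_ofReal (by positivity), ENNReal.toReal_ofNat] at this
  rw [hrew, ← ENNReal.ofReal_mul (by linarith), ← enorm_eq_nnnorm, ← ofReal_norm]
  apply ENNReal.ofReal_le_ofReal
  refine le_trans ?_ ((hge.trans (le_abs_self _)))
  have h5 : 0 < b x - m := by linarith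
  calc _ = ((2 * R) ^ (n:ℝ) / 2) * ((b x - m) * (((n + 1) * (6 * R)) ^ ((n:ℝ) - γ))⁻¹) := by ring
    _ ≤ _ := by gcongr

lemma one_side (n : ℕ) (hn : 1 ≤ n) (γ : ℝ) (hγn : γ < n)
    (p q s : Fin n → ℝ≥0∞) (α β : ℝ≥0∞)
    (hp : ∀ i, 1 < p i ∧ p i < ∞) (hq : ∀ i, 1 < q i ∧ q i < ∞) (hs : ∀ i, 1 < s i)
    (hα1 : invSum n s / (n : ℝ) ≤ (1 / α).toReal)
    (hα2 : (1 / α).toReal ≤ invSum n p / (n : ℝ))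
    (hβ2 : (1 / β).toReal ≤ invSum n q / (n : ℝ))
    (hγαβ : γ = (n : ℝ) * (1 / α).toReal - (n : ℝ) * (1 / β).toReal) (C : ℝ≥0∞) (hC : C < ∞) :
    ∃ K : ℝ, 0 ≤ K ∧ ∀ (b b' : (Fin n → ℝ) → ℝ) (_ : LocallyIntegrable b volume) (_ : Measurable b')
    (_ : b =ᵐ[volume] b')
    (_ : ∀ f : (Fin n → ℝ) → ℝ, memA n p s α f →
        amalgamNormA n q s β (commFracInt n γ b f) ≤ C * amalgamNormA n p s α f)
     (x₀ : Fin n → ℝ) (R : ℝ) (_ : 0 < R) (m : ℝ)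
    (_ : volume (bx n (fun i => x₀ i + 4 * R) R) / 2 ≤
      volume (bx n (fun i => x₀ i + 4 * R) R ∩ {y | b' y ≤ m})),
    ∫⁻ x in bx n x₀ R, ENNReal.ofReal (b x - m) ≤ ENNReal.ofReal (K * R ^ (n:ℝ)) := by
  obtain ⟨K1, hK1, H1⟩ := norm_test n hn p s α (fun i => (hp i).1) hs hα1 hα2
  obtain ⟨K2, hK2, H2⟩ := norm_lower n hn q s β hq hs hβ2
  set K3 : ℝ := (((n:ℝ) + 1) * 6) ^ (γ - n) * (2 ^ (n:ℝ) / 2) with hK3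
  have hK3p : 0 < K3 := by positivity
  refine ⟨C.toReal * K1 * K2 / K3, by positivity, ?_⟩
  intro b b' hb hm' hbb hbound x₀ R hR m hE
  set E := bx n (fun i => x₀ i + 4 * R) R ∩ {y | b' y ≤ m} with hEdef
  have hEm : MeasurableSet E := (bx_meas _ _ _).inter (measurableSet_le hm' measurable_const)
  have hEfin : volume E ≠ ∞ := by
    refine ne_top_of_le_ne_top ?_ (measure_mono Set.inter_subset_left)
    rw [vol_bx n _ hR]; exact ENNReal.ofReal_ne_top
  have hf := H1 (fun i => x₀ i + 4 * R) R hR (E.indicator 1) (by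
    intro y
    by_cases hy : y ∈ E
    · rw [Set.indicator_of_mem hy, Set.indicator_of_mem hy.1]; simp
    · rw [Set.indicator_of_notMem hy, norm_zero]
      exact Set.indicator_nonneg (by simp) _)
  have hmem : memA n p s α (E.indicator 1) := by
    refine ⟨?_, hf.trans_lt ENNReal.ofReal_lt_top⟩
    have : Integrable (E.indicator (1 : (Fin n → ℝ) → ℝ)) volume :=
      (integrable_indicator_iff hEm).2 (integrableOn_const hEfin)
    exact this.locallyIntegrable
  have h3 := hbound _ hmem
  have h4 := H2 x₀ R hR (commFracInt n γ b (E.indicator 1))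
  have hlow : ∫⁻ x in bx n x₀ R, ENNReal.ofReal (b x - m) *
      ENNReal.ofReal ((((n + 1) * (6 * R)) ^ ((n:ℝ) - γ))⁻¹ * ((2 * R) ^ (n : ℝ) / 2)) ≤
      ∫⁻ x in bx n x₀ R, (‖commFracInt n γ b (E.indicator 1) x‖₊ : ℝ≥0∞) := by
    refine setLIntegral_mono' (bx_meas _ _ _) fun x hx => ?_
    exact comm_lower n hn γ hγn b b' hb hm' hbb x₀ R hR m hE x hx
  rw [lintegral_mul_const' _ _ ENNReal.ofReal_ne_top] at hlow
  have hk : (((n + 1) * (6 * R)) ^ ((n:ℝ) - γ))⁻¹ * ((2 * R) ^ (n : ℝ) / 2) = K3 * R ^ γ := by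
    rw [← Real.rpow_neg (by positivity), ← mul_assoc ((n:ℝ) + 1), Real.mul_rpow (by positivity) hR.le, Real.mul_rpow (by positivity) hR.le, hK3]
    have : R ^ γ = R ^ (-((n:ℝ) - γ)) * R ^ (n:ℝ) := by
      rw [← Real.rpow_add hR]; congr 1; ring
    rw [this, neg_sub]; ring
  rw [hk] at hlow
  set I := ∫⁻ x in bx n x₀ R, ENNReal.ofReal (b x - m) with hI
  have h5 : I * ENNReal.ofReal (K3 * R ^ γ) ≤ ENNReal.ofReal (C.toReal * K1 * K2 * R ^ (n + γ)) := by
    refine (hlow.trans h4).trans ?_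
    refine (mul_le_mul_left (h3.trans (mul_le_mul_right hf C)) _).trans (le_of_eq ?_)
    nth_rewrite 1 [← ENNReal.ofReal_toReal hC.ne]
    rw [← ENNReal.ofReal_mul (by positivity), ← ENNReal.ofReal_mul (by positivity)]
    congr 1
    have : R ^ (n + γ) = R ^ (n * (1 / α).toReal) * R ^ ((n:ℝ) - n * (1 / β).toReal) := by
      rw [← Real.rpow_add hR, hγαβ]; congr 1; ring
    rw [this]; ring
  have hpos : 0 < K3 * R ^ γ := by positivity
  rw [← ENNReal.le_div_iff_mul_le (Or.inl (by simpa using hpos)) (Or.inl ENNReal.ofReal_ne_top), ← ENNReal.ofReal_div_of_pos hpos] at h5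
  refine h5.trans (le_of_eq ?_)
  congr 1
  rw [Real.rpow_add hR]
  have : 0 < R ^ γ := by positivity
  field_simp

/-- If the commutator `[b, I_γ]` is bounded from
`(L^{p⃗},L^{s⃗})^α(ℝⁿ)` to `(L^{q⃗},L^{s⃗})^β(ℝⁿ)`, then `b ∈ BMO(ℝⁿ)`. -/
theorem statement18 (n : ℕ) (hn : 1 ≤ n) (γ : ℝ) (hγ0 : 0 < γ) (hγn : γ < n)
    (p q s : Fin n → ℝ≥0∞) (α β : ℝ≥0∞)
    (hp : ∀ i, 1 < p i ∧ p i < ∞) (hq : ∀ i, 1 < q i ∧ q i < ∞) (hs : ∀ i, 1 < s i)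
    (hα1 : invSum n s / (n : ℝ) ≤ (1 / α).toReal)
    (hα2 : (1 / α).toReal ≤ invSum n p / (n : ℝ))
    (hβ1 : invSum n s / (n : ℝ) ≤ (1 / β).toReal)
    (hβ2 : (1 / β).toReal ≤ invSum n q / (n : ℝ))
    (hγpq : γ = invSum n p - invSum n q)
    (hγαβ : γ = (n : ℝ) * (1 / α).toReal - (n : ℝ) * (1 / β).toReal)
    (b : (Fin n → ℝ) → ℝ) (hb : LocallyIntegrable b volume)
    (hbound : ∃ C : ℝ≥0∞, 0 < C ∧ C < ∞ ∧
      ∀ f : (Fin n → ℝ) → ℝ, memA n p s α f →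
        amalgamNormA n q s β (commFracInt n γ b f) ≤ C * amalgamNormA n p s α f) :
    bmoNorm n b < ∞ := by
  obtain ⟨C, _, hC, hbound⟩ := hbound
  obtain ⟨K, hK0, H⟩ := one_side n hn γ hγn p q s α β hp hq hs hα1 hα2 hβ2 hγαβ C hC
  obtain ⟨b', hm', hbb⟩ : ∃ b', Measurable b' ∧ b =ᵐ[volume] b' :=
    ⟨_, hb.aestronglyMeasurable.stronglyMeasurable_mk.measurable, hb.aestronglyMeasurable.ae_eq_mk⟩
  have hboundn : ∀ f : (Fin n → ℝ) → ℝ, memA n p s α f →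
        amalgamNormA n q s β (commFracInt n γ (-b) f) ≤ C * amalgamNormA n p s α f := by
    intro f hf
    refine le_trans (le_of_eq ?_) (hbound f hf)
    have : commFracInt n γ (-b) f = fun x => - commFracInt n γ b f x := by
      ext x
      unfold commFracInt
      rw [← integral_neg]
      congr 1
      ext y
      simp only [Pi.neg_apply]
      ring
    rw [this]
    unfold amalgamNormA mixedLp
    have hz : ∀ (r : ℝ) (y z : Fin n → ℝ),
        ‖(eball n y r).indicator (fun x => - commFracInt n γ b f x) z‖₊ =
        ‖(eball n y r).indicator (commFracInt n γ b f) z‖₊ := by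
      intro r y z
      by_cases hz : z ∈ eball n y r
      · rw [Set.indicator_of_mem hz, Set.indicator_of_mem hz, nnnorm_neg]
      · rw [Set.indicator_of_notMem hz, Set.indicator_of_notMem hz]
    simp only [hz]
  have main : ∀ (y : Fin n → ℝ) (r : ℝ), 0 < r →
      (volume (eball n y r)).toReal⁻¹ * ∫ x in eball n y r, |b x - ballAvg n b y r| ≤
        4 * K * (((n:ℝ) + 1) / 2) ^ (n:ℝ) := by
    intro y r hr
    set Q := bx n (fun i => y i + 4 * r) r with hQ
    have hQfin : volume Q ≠ ∞ := by rw [hQ, vol_bx n _ hr]; exact ENNReal.ofReal_ne_top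
    have : IsFiniteMeasure (volume.restrict Q) := ⟨by simpa using hQfin.lt_top⟩
    obtain ⟨m, h1, h2⟩ := exists_median ((volume.restrict Q).map b')
    rw [Measure.map_apply hm' MeasurableSet.univ, Measure.map_apply hm' measurableSet_Iic,
      Measure.restrict_apply (hm' measurableSet_Iic), preimage_univ, Measure.restrict_apply_univ,
      Set.inter_comm] at h1
    rw [Measure.map_apply hm' MeasurableSet.univ, Measure.map_apply hm' measurableSet_Ici,
      Measure.restrict_apply (hm' measurableSet_Ici), preimage_univ, Measure.restrict_apply_univ,
      Set.inter_comm] at h2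
    have u1 := H b b' hb hm' hbb hbound y r hr m h1
    have u2 := H (-b) (-b') hb.neg hm'.neg hbb.neg hboundn y r hr (-m) (by
      refine h2.trans (measure_mono ?_)
      intro z hz
      refine ⟨hz.1, ?_⟩
      have : m ≤ b' z := hz.2
      simpa using this)
    set B := eball n y r with hB
    have hBQ : B ⊆ bx n y r := eball_sub_bx n y r
    have hBfin : volume B ≠ ∞ :=
      ne_top_of_le_ne_top ENNReal.ofReal_ne_top (vol_eball_le n y hr)
    have hvB : (2 * (r / (n + 1))) ^ (n : ℝ) ≤ (volume B).toReal :=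
      (ENNReal.ofReal_le_iff_le_toReal hBfin).1 (le_vol_eball n y hr)
    have hv0 : 0 < (2 * (r / ((n:ℝ) + 1))) ^ (n : ℝ) := by positivity
    have hvB0 : 0 < (volume B).toReal := hv0.trans_le hvB
    have hbB : IntegrableOn b B := by
      refine (hb.integrableOn_isCompact (isCompact_closedBall y r)).mono_set ?_
      intro z hz
      rw [Metric.mem_closedBall, dist_pi_le_iff hr.le]
      intro i
      exact (mem_bx.1 (hBQ hz) i).le
    have hc : ∀ c : ℝ, IntegrableOn (fun _ => c) B := fun c => integrableOn_const hBfin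
    have hbm : IntegrableOn (fun x => b x - m) B := hbB.sub (hc m)
    have hA : ∫ x in B, |b x - m| ≤ 2 * K * r ^ (n:ℝ) := by
      have e1 : ∫ x in B, |b x - m| = (∫⁻ x in B, ‖b x - m‖ₑ).toReal :=
        integral_norm_eq_lintegral_enorm hbm.aestronglyMeasurable
      rw [e1]
      apply ENNReal.toReal_le_of_le_ofReal (by positivity)
      have e2 : ∀ x, ‖b x - m‖ₑ ≤ ENNReal.ofReal (b x - m) + ENNReal.ofReal ((-b) x - (-m)) := by
        intro x
        rw [← ofReal_norm]
        rcases le_total 0 (b x - m) with h | h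
        · rw [Real.norm_of_nonneg h]; exact le_self_add
        · rw [Real.norm_of_nonpos h]
          refine le_trans (le_of_eq ?_) le_add_self
          congr 1
          simp only [Pi.neg_apply]; ring
      calc ∫⁻ x in B, ‖b x - m‖ₑ ≤ ∫⁻ x in bx n y r, ‖b x - m‖ₑ := lintegral_mono_set hBQ
        _ ≤ ∫⁻ x in bx n y r, (ENNReal.ofReal (b x - m) + ENNReal.ofReal ((-b) x - (-m))) :=
            lintegral_mono e2
        _ = (∫⁻ x in bx n y r, ENNReal.ofReal (b x - m)) +
              ∫⁻ x in bx n y r, ENNReal.ofReal ((-b) x - (-m)) := by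
            apply lintegral_add_left'
            exact (hb.aestronglyMeasurable.aemeasurable.sub_const m).ennreal_ofReal.restrict
        _ ≤ ENNReal.ofReal (K * r ^ (n:ℝ)) + ENNReal.ofReal (K * r ^ (n:ℝ)) := add_le_add u1 u2
        _ = _ := by
            rw [← ENNReal.ofReal_add (by positivity) (by positivity)]; congr 1; ring
    have hD : ∫ x in B, |b x - ballAvg n b y r| ≤ 2 * ∫ x in B, |b x - m| := by
      set A := ballAvg n b y r with hAv
      have e3 : (volume B).toReal * (A - m) = ∫ x in B, (b x - m) := by
        have : ∫ x in B, (b x - m) = (∫ x in B, b x) - ∫ x in B, m := integral_sub hbB (hc m)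
        rw [this, hAv, ballAvg, ← hB, setIntegral_const, mul_sub, mul_inv_cancel_left₀ hvB0.ne']
        simp [Measure.real]
      have e4 : (volume B).toReal * |A - m| ≤ ∫ x in B, |b x - m| := by
        rw [← abs_of_pos hvB0, ← abs_mul, e3]
        exact abs_integral_le_integral_abs
      calc ∫ x in B, |b x - A| ≤ ∫ x in B, (|b x - m| + |A - m|) := by
            refine integral_mono (hbB.sub (hc A)).abs (hbm.abs.add (hc _)) fun x => ?_
            have := abs_sub (b x - m) (A - m)
            simpa using this
        _ = (∫ x in B, |b x - m|) + (volume B).toReal * |A - m| := by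
            have := integral_add hbm.abs (hc |A - m|)
            rw [this, setIntegral_const]; simp [Measure.real]
        _ ≤ _ := by linarith
    rw [inv_mul_le_iff₀ hvB0]
    have e5 : r ^ (n:ℝ) = (2 * (r / ((n:ℝ) + 1))) ^ (n : ℝ) * (((n:ℝ) + 1) / 2) ^ (n:ℝ) := by
      rw [← Real.mul_rpow (by positivity) (by positivity)]
      congr 1
      field_simp
    have e6 : r ^ (n:ℝ) ≤ (volume B).toReal * (((n:ℝ) + 1) / 2) ^ (n:ℝ) := by
      rw [e5]; gcongr
    nlinarith [mul_le_mul_of_nonneg_left e6 hK0]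
  refine lt_of_le_of_lt ?_ (ENNReal.ofReal_lt_top (r := 4 * K * (((n:ℝ) + 1) / 2) ^ (n:ℝ)))
  exact iSup_le fun y => iSup₂_le fun r hr => ENNReal.ofReal_le_ofReal (main y r hr)

end MixedAmalgam

end
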